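/- Let λ/μ be a skew partition of size n (μ ⊆ λ as Young diagrams, n the number of boxes of λ/μ). Then any two standard Young tableaux of shape λ/μ can be obtained one from the other by a finite sequence of elementary transpositions, each exchanging the entries i and i+1 for some 1 ≤ i ≤ n−1, in such a way that the tableau remains standard after every step. -/

import Mathlib

/-- The set of cells of the skew shape `λ/μ`. -/
def skewCells (lam mu : YoungDiagram) : Finset (ℕ × ℕ) := lam.cells \ mu.cells

/-- A standard Young tableau of the skew shape `λ/μ` of size `n`: a filling of the cells of
`λ/μ` (vanishing outside) which is a bijection onto `{1, …, n}` and strictly increases along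
rows and down columns. -/
def IsSkewStandard (lam mu : YoungDiagram) (n : ℕ) (f : ℕ × ℕ → ℕ) : Prop :=
  (∀ c, c ∉ skewCells lam mu → f c = 0) ∧
  Set.BijOn f (↑(skewCells lam mu)) (Set.Icc 1 n) ∧
  (∀ i j j', (i, j) ∈ skewCells lam mu → (i, j') ∈ skewCells lam mu → j < j' →
    f (i, j) < f (i, j')) ∧
  (∀ i i' j, (i, j) ∈ skewCells lam mu → (i', j) ∈ skewCells lam mu → i < i' →
    f (i, j) < f (i', j))

/-- The elementary transposition exchanging the entries `i` and `i+1` of a tableau. -/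
def swapEntries (i : ℕ) (f : ℕ × ℕ → ℕ) : ℕ × ℕ → ℕ := fun c => Equiv.swap i (i + 1) (f c)

theorem swapEntries_isSkewStandard {lam mu : YoungDiagram} {n i : ℕ} {f : ℕ × ℕ → ℕ}
    (hf : IsSkewStandard lam mu n f) (hi : 1 ≤ i) (hin : i + 1 ≤ n) {c d : ℕ × ℕ}
    (hfc : f c = i) (hfd : f d = i + 1)
    (hc : c ∈ skewCells lam mu) (hd : d ∈ skewCells lam mu)
    (hrow : c.1 = d.1 → ¬ c.2 < d.2) (hcol : c.2 = d.2 → ¬ c.1 < d.1) :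
    IsSkewStandard lam mu n (swapEntries i f) := by
  obtain ⟨hzero, hbij, hr, hk⟩ := hf
  have swap_lt : ∀ x y : ℕ, x < y → ¬ (x = i ∧ y = i + 1) →
      Equiv.swap i (i + 1) x < Equiv.swap i (i + 1) y := by
    intro x y hxy h
    simp only [Equiv.swap_apply_def]
    split_ifs <;> omega
  have hswap : Set.BijOn (Equiv.swap i (i + 1)) (Set.Icc 1 n) (Set.Icc 1 n) := by
    have hmaps : Set.MapsTo (Equiv.swap i (i + 1)) (Set.Icc 1 n) (Set.Icc 1 n) := by
      intro x hx
      simp only [Set.mem_Icc, Equiv.swap_apply_def] at hx ⊢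
      split_ifs <;> omega
    exact ⟨hmaps, (Equiv.injective _).injOn, fun x hx => ⟨_, hmaps hx, by simp⟩⟩
  refine ⟨fun e he => ?_, hswap.comp hbij, fun a b b' h h' hlt => ?_, fun a a' b h h' hlt => ?_⟩
  · simp only [swapEntries, hzero e he]
    exact Equiv.swap_apply_of_ne_of_ne (by omega) (by omega)
  · refine swap_lt _ _ (hr _ _ _ h h' hlt) ?_
    rintro ⟨h1, h2⟩
    obtain rfl : (a, b) = c := hbij.injOn h hc (h1.trans hfc.symm)
    obtain rfl : (a, b') = d := hbij.injOn h' hd (h2.trans hfd.symm)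
    exact hrow rfl hlt
  · refine swap_lt _ _ (hk _ _ _ h h' hlt) ?_
    rintro ⟨h1, h2⟩
    obtain rfl : (a, b) = c := hbij.injOn h hc (h1.trans hfc.symm)
    obtain rfl : (a', b) = d := hbij.injOn h' hd (h2.trans hfd.symm)
    exact hcol rfl hlt

/-- Two distinct enumerations of a set disagree on the order of two elements that are consecutive
for the first one. -/
theorem Set.BijOn.exists_adjacent_inversion {α : Type*} {s : Set α} {n : ℕ} {f g : α → ℕ}
    (hf : Set.BijOn f s (Set.Icc 1 n)) (hg : Set.BijOn g s (Set.Icc 1 n))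
    (hne : ¬ Set.EqOn f g s) :
    ∃ c ∈ s, ∃ d ∈ s, f d = f c + 1 ∧ g d < g c := by
  by_contra! H
  apply hne
  have step : ∀ c ∈ s, ∀ d ∈ s, f d = f c + 1 → g c + 1 ≤ g d := by
    intro c hc d hd h
    refine lt_of_le_of_ne (H c hc d hd h) fun he => ?_
    have := hg.injOn hc hd he
    subst this
    omega
  have lower : ∀ k, ∀ c ∈ s, f c = k → k ≤ g c := by
    intro k
    induction k with
    | zero => intros; omega
    | succ k ih =>
      intro d hd hfd
      rcases Nat.eq_zero_or_pos k with rfl | hk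
      · exact (hg.mapsTo hd).1
      · have := (hf.mapsTo hd).2
        obtain ⟨c, hc, hfc⟩ := hf.surjOn (show k ∈ Set.Icc 1 n from ⟨hk, by omega⟩)
        have := step c hc d hd (by omega)
        have := ih c hc hfc
        omega
  have upper : ∀ k, ∀ c ∈ s, f c + k = n → g c ≤ f c := by
    intro k
    induction k with
    | zero =>
      intro c hc h
      have := (hg.mapsTo hc).2
      omega
    | succ k ih =>
      intro c hc h
      obtain ⟨d, hd, hfd⟩ := hf.surjOn (show f c + 1 ∈ Set.Icc 1 n from ⟨by omega, by omega⟩)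
      have := step c hc d hd hfd
      have := ih d hd (by omega)
      omega
  intro c hc
  have := (hf.mapsTo hc).2
  exact le_antisymm (lower _ c hc rfl) (upper (n - f c) c hc (by omega))

theorem sum_mul_lt_sum_swapEntries_mul {s : Finset (ℕ × ℕ)} {f g : ℕ × ℕ → ℕ}
    (hinj : Set.InjOn f s) {c d : ℕ × ℕ} (hc : c ∈ s) (hd : d ∈ s) (hfd : f d = f c + 1)
    (hlt : g d < g c) :
    ∑ e ∈ s, f e * g e < ∑ e ∈ s, swapEntries (f c) f e * g e := by
  have hdc : d ∈ s.erase c := Finset.mem_erase.2 ⟨by rintro rfl; omega, hd⟩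
  rw [← Finset.add_sum_erase s _ hc, ← Finset.add_sum_erase s _ hc,
    ← Finset.add_sum_erase _ _ hdc, ← Finset.add_sum_erase _ _ hdc]
  have hrest : ∑ e ∈ (s.erase c).erase d, swapEntries (f c) f e * g e =
      ∑ e ∈ (s.erase c).erase d, f e * g e := by
    refine Finset.sum_congr rfl fun e he => ?_
    simp only [Finset.mem_erase] at he
    have h1 : f e ≠ f c := fun h => he.2.1 (hinj he.2.2 hc h)
    have h2 : f e ≠ f c + 1 := fun h => he.1 (hinj he.2.2 hd (h.trans hfd.symm))
    rw [swapEntries, Equiv.swap_apply_of_ne_of_ne h1 h2]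
  have hsc : swapEntries (f c) f c = f c + 1 := Equiv.swap_apply_left _ _
  have hsd : swapEntries (f c) f d = f c := by
    rw [swapEntries, hfd, Equiv.swap_apply_right]
  rw [hrest, hsc, hsd, hfd]
  nlinarith

/-- Any two standard Young tableaux of the skew shape `λ/μ` can be obtained one from the other
by a finite sequence of elementary transpositions `s_i` (`1 ≤ i ≤ n−1`), the tableau remaining
standard after every step. -/
theorem stmt0 (lam mu : YoungDiagram) (hsub : mu.cells ⊆ lam.cells) (n : ℕ)
    (hn : n = lam.card - mu.card)
    (f g : ℕ × ℕ → ℕ) (hf : IsSkewStandard lam mu n f) (hg : IsSkewStandard lam mu n g) :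
    Relation.ReflTransGen
      (fun a b : ℕ × ℕ → ℕ =>
        IsSkewStandard lam mu n b ∧ ∃ i, 1 ≤ i ∧ i + 1 ≤ n ∧ b = swapEntries i a)
      f g := by
  set s := skewCells lam mu
  have bound : ∀ f, IsSkewStandard lam mu n f →
      ∑ e ∈ s, f e * g e ≤ s.card * (n * n) := by
    intro f hf
    rw [← smul_eq_mul]
    exact Finset.sum_le_card_nsmul _ _ _ fun e he =>
      Nat.mul_le_mul (hf.2.1.mapsTo he).2 (hg.2.1.mapsTo he).2
  induction hm : s.card * (n * n) - ∑ e ∈ s, f e * g e using Nat.strong_induction_on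
    generalizing f with
  | _ m ih =>
    by_cases heq : Set.EqOn f g s
    · have : f = g := by
        funext e
        by_cases he : e ∈ s
        · exact heq he
        · rw [hf.1 e he, hg.1 e he]
      exact this ▸ Relation.ReflTransGen.refl
    · obtain ⟨c, hc, d, hd, hfd, hlt⟩ := hf.2.1.exists_adjacent_inversion hg.2.1 heq
      have hi : 1 ≤ f c := (hf.2.1.mapsTo hc).1
      have hin : f c + 1 ≤ n := hfd ▸ (hf.2.1.mapsTo hd).2
      have hstd : IsSkewStandard lam mu n (swapEntries (f c) f) := by
        obtain ⟨a, b⟩ := c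
        obtain ⟨a', b'⟩ := d
        refine swapEntries_isSkewStandard hf hi hin rfl hfd hc hd ?_ ?_
        · rintro rfl h
          exact hlt.not_gt (hg.2.2.1 _ _ _ hc hd h)
        · rintro rfl h
          exact hlt.not_gt (hg.2.2.2 _ _ _ hc hd h)
      have hsum := sum_mul_lt_sum_swapEntries_mul (s := s) hf.2.1.injOn hc hd hfd hlt
      have hle := bound _ hstd
      exact Relation.ReflTransGen.head ⟨hstd, f c, hi, hin, rfl⟩
        (ih _ (by omega) _ hstd rfl)
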